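/- Existence of a piecewise-affine function with positive Kirchhoff sums (Lemma 4.2). Let β = (β_{ij}) be weights with β_{ij} > 0 for every i ∈ I_T and j ∈ Inc_i. Then there exist a function φ ∈ C²(Γ) and a vector (α_j)_{j∈J} with α_j ≠ 0 for all j ∈ J such that ∂_j φ(x) = α_j for all x ∈ [0,l_j] and all j ∈ J (i.e., each φ^j is affine with slope α_j), and S^i_β φ > 0 for every i ∈ I_T. -/

import Mathlib

open Set

noncomputable section

/-- A finite connected topological network. -/
structure Network where
  I : Type
  J : Type
  finI : Fintype I
  finJ : Fintype J
  neI : Nonempty I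
  neJ : Nonempty J
  l : J → ℝ
  l_pos : ∀ j, 0 < l j
  s : J → I
  t : J → I
  st_ne : ∀ j, s j ≠ t j
  conn : ∀ i i' : I,
    Relation.ReflTransGen (fun a b => ∃ j, (s j = a ∧ t j = b) ∨ (s j = b ∧ t j = a)) i i'
  IB : Set I
  IB_ne : IB.Nonempty
  deg_one_bd : ∀ i : I, ({j : J | s j = i ∨ t j = i} : Set J).ncard = 1 → i ∈ IB

attribute [instance] Network.finI Network.finJ Network.neI Network.neJ

namespace Network

open scoped Classical

variable (N : Network)

/-- The set of edges incident to the vertex `i`. -/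
def Inc (i : N.I) : Set N.J := {j | N.s j = i ∨ N.t j = i}

/-- The set of transition vertices. -/
def IT : Set N.I := N.IBᶜ

/-- The signed incidence `a_{ij}`. -/
def sgn (i : N.I) (j : N.J) : ℝ := if N.s j = i then 1 else -1

/-- The parameter `y_i^j` of the vertex `i` on the edge `j`. -/
def param (i : N.I) (j : N.J) : ℝ := if N.s j = i then 0 else N.l j

/-- The edge `j` as a parameter interval. -/
def edge (j : N.J) : Set ℝ := Icc 0 (N.l j)

/-- A family `(u^j)` of functions on the edges defines a function on the network iff
the values at each vertex agree. -/
def Compat (u : N.J → ℝ → ℝ) : Prop :=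
  ∀ i : N.I, ∀ j ∈ N.Inc i, ∀ k ∈ N.Inc i, u j (N.param i j) = u k (N.param i k)

/-- `u ∈ C(Γ)`. -/
def IsCont (u : N.J → ℝ → ℝ) : Prop :=
  N.Compat u ∧ ∀ j, ContinuousOn (u j) (N.edge j)

/-- `u ∈ C²(Γ)`. -/
def IsC2 (u : N.J → ℝ → ℝ) : Prop :=
  N.Compat u ∧ ∀ j, ContDiffOn ℝ 2 (u j) (N.edge j)

/-- First derivative `∂_j u` along the edge `j`. -/
def pd (u : N.J → ℝ → ℝ) (j : N.J) (x : ℝ) : ℝ := derivWithin (u j) (N.edge j) x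

/-- Second derivative `∂²_j u` along the edge `j`. -/
def pd2 (u : N.J → ℝ → ℝ) (j : N.J) (x : ℝ) : ℝ := derivWithin (N.pd u j) (N.edge j) x

/-- Sum over the edges incident to `i`. -/
def incSum (i : N.I) (f : N.J → ℝ) : ℝ := ∑ j : N.J, if j ∈ N.Inc i then f j else 0

/-- The Kirchhoff sum `S^i_β u`. -/
def kir (β : N.I → N.J → ℝ) (u : N.J → ℝ → ℝ) (i : N.I) : ℝ :=
  N.incSum i (fun j => β i j * N.sgn i j * N.pd u j (N.param i j))

/-- `u ∈ C²_{*,β}(Γ)`. -/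
def IsC2Star (β : N.I → N.J → ℝ) (u : N.J → ℝ → ℝ) : Prop :=
  N.IsC2 u ∧ ∀ i ∈ N.IT, N.kir β u i = 0

/-- (H0): continuity of each `H^j`. -/
def H0 (H : N.J → ℝ → ℝ → ℝ → ℝ) : Prop :=
  ∀ j, ContinuousOn (fun q : ℝ × ℝ × ℝ => H j q.1 q.2.1 q.2.2)
    ((N.edge j) ×ˢ (univ : Set ℝ) ×ˢ (univ : Set ℝ))

/-- (H1): `r ↦ H^j(x,r,p)` is nondecreasing. -/
def H1 (H : N.J → ℝ → ℝ → ℝ → ℝ) : Prop :=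
  ∀ j, ∀ x ∈ N.edge j, ∀ p : ℝ, Monotone fun r => H j x r p

/-- (H3): `p ↦ H^j(v_i,r,p)` is nondecreasing on `(0,∞)` at transition vertices. -/
def H3 (H : N.J → ℝ → ℝ → ℝ → ℝ) : Prop :=
  ∀ i ∈ N.IT, ∀ j ∈ N.Inc i, ∀ r : ℝ,
    MonotoneOn (fun p => H j (N.param i j) r p) (Ioi (0 : ℝ))

/-- (H4): coercivity in `p`, uniform on bounded `r`-sets. -/
def H4 (H : N.J → ℝ → ℝ → ℝ → ℝ) : Prop :=
  ∀ j, ∀ R : ℝ, 0 < R → ∀ A : ℝ, ∃ M : ℝ, ∀ x ∈ N.edge j, ∀ r : ℝ, |r| ≤ R →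
    ∀ p : ℝ, M < |p| → A < H j x r p

/-- (H5): continuity of `H` at the transition vertices. -/
def H5 (H : N.J → ℝ → ℝ → ℝ → ℝ) : Prop :=
  ∀ i ∈ N.IT, ∀ j ∈ N.Inc i, ∀ k ∈ N.Inc i, ∀ r p : ℝ,
    H j (N.param i j) r p = H k (N.param i k) r p

/-- (H6): symmetry of `H` in `p` at the transition vertices. -/
def H6 (H : N.J → ℝ → ℝ → ℝ → ℝ) : Prop :=
  ∀ i ∈ N.IT, ∀ j ∈ N.Inc i, ∀ r p : ℝ,
    H j (N.param i j) r p = H j (N.param i j) r (-p)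

end Network

/-- In a finite connected graph the vertices can be ranked injectively so that every vertex other
than the root `b` has a neighbour of smaller rank. -/
theorem SimpleGraph.Connected.exists_injective_rank {V : Type*} [Finite V] {G : SimpleGraph V}
    (hG : G.Connected) (b : V) :
    ∃ r : V → ℕ, Function.Injective r ∧ ∀ v, v ≠ b → ∃ w, G.Adj v w ∧ r w < r v := by
  obtain ⟨n, ⟨e⟩⟩ := Finite.exists_equiv_fin V
  have hmod (v : V) : (n * G.dist v b + e v) % n = e v := by
    rw [Nat.mul_add_mod, Nat.mod_eq_of_lt (e v).isLt]
  refine ⟨fun v => n * G.dist v b + e v, fun v w hvw => ?_, fun v hv => ?_⟩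
  · have h := congrArg (· % n) hvw
    simp only [hmod] at h
    exact e.injective (Fin.ext h)
  · obtain ⟨p, hp⟩ := hG.exists_walk_length_eq_dist v b
    cases p with
    | nil => exact absurd rfl hv
    | @cons _ w _ h q =>
      refine ⟨w, h, ?_⟩
      have hd : G.dist w b + 1 ≤ G.dist v b := by
        rw [← hp, SimpleGraph.Walk.length_cons]
        exact Nat.succ_le_succ (SimpleGraph.dist_le q)
      calc n * G.dist w b + e w < n * (G.dist w b + 1) := by
            rw [mul_add, mul_one]
            exact Nat.add_lt_add_left (e w).isLt _
        _ ≤ n * G.dist v b := Nat.mul_le_mul_left n hd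
        _ ≤ n * G.dist v b + e v := Nat.le_add_right _ _

/-- A finite array of reals admits a small ratio `ε` such that `ε` times any row sum is below
every positive entry of that row. -/
theorem exists_mul_sum_lt_of_pos {I J : Type*} [Finite I] [Fintype J] (c : I → J → ℝ) :
    ∃ ε : ℝ, 0 < ε ∧ ε < 1 ∧ ∀ i j, 0 < c i j → ε * ∑ k, c i k < c i j := by
  have h : ∀ᶠ ε : ℝ in nhdsWithin 0 (Ioi 0), ∀ i j, 0 < c i j → ε * ∑ k, c i k < c i j := by
    refine Filter.eventually_all.2 fun i => Filter.eventually_all.2 fun j => ?_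
    by_cases hij : 0 < c i j
    · have ht : Filter.Tendsto (fun ε : ℝ => ε * ∑ k, c i k) (nhds 0) (nhds 0) :=
        Continuous.tendsto' (by fun_prop) _ _ (zero_mul _)
      filter_upwards [(ht.mono_left nhdsWithin_le_nhds).eventually_lt_const hij] with ε hε _
      exact hε
    · exact Filter.Eventually.of_forall fun _ h => absurd h hij
  obtain ⟨ε, hε, h0, h1⟩ := (h.and (Ioo_mem_nhdsGT (zero_lt_one' ℝ))).exists
  exact ⟨ε, h0, h1, hε⟩

/-- If some positively weighted exponent is below `n`, then the weighted sum of the increments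
`ε ^ m k - ε ^ n` is positive once `ε` is small relative to the weights. -/
theorem sum_mul_pow_sub_pow_pos {J : Type*} [Fintype J] {c : J → ℝ} (hc : ∀ k, 0 ≤ c k)
    {ε : ℝ} (h0 : 0 < ε) (h1 : ε < 1) {m : J → ℕ} {n : ℕ} {j : J}
    (hε : ε * ∑ k, c k < c j) (hj : m j < n) :
    0 < ∑ k, c k * (ε ^ m k - ε ^ n) := by
  obtain ⟨p, rfl⟩ : ∃ p, n = p + 1 := ⟨n - 1, by omega⟩
  have hle : c j * ε ^ p ≤ ∑ k, c k * ε ^ m k :=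
    (mul_le_mul_of_nonneg_left (pow_le_pow_of_le_one h0.le h1.le (Nat.le_of_lt_succ hj))
      (hc j)).trans
      (Finset.single_le_sum (f := fun k => c k * ε ^ m k)
        (fun k _ => mul_nonneg (hc k) (pow_nonneg h0.le _)) (Finset.mem_univ j))
  have hlt := mul_lt_mul_of_pos_right hε (pow_pos h0 p)
  simp only [mul_sub, Finset.sum_sub_distrib, ← Finset.sum_mul]
  rw [pow_succ']
  linarith

namespace Network

open scoped Classical

variable (N : Network)

/-- The simple graph underlying a network. -/
def graph : SimpleGraph N.I where
  Adj a b := ∃ j, (N.s j = a ∧ N.t j = b) ∨ (N.s j = b ∧ N.t j = a)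
  symm := ⟨fun _ _ ⟨j, h⟩ => ⟨j, h.symm⟩⟩
  loopless := ⟨fun _ ⟨j, h⟩ => N.st_ne j (by grind)⟩

theorem graph_connected : N.graph.Connected where
  preconnected i i' := (SimpleGraph.reachable_iff_reflTransGen i i').2 (N.conn i i')
  nonempty := N.neI

/-- The end of the edge `j` opposite to `i`. -/
def opp (i : N.I) (j : N.J) : N.I := if N.s j = i then N.t j else N.s j

/-- The slope along `j` of the affine interpolation of the vertex values `f`. -/
def slope (f : N.I → ℝ) (j : N.J) : ℝ := (f (N.t j) - f (N.s j)) / N.l j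

/-- The function on the network that is affine on each edge and has vertex values `f`. -/
def interp (f : N.I → ℝ) (j : N.J) (x : ℝ) : ℝ := f (N.s j) + N.slope f j * x

theorem interp_param (f : N.I → ℝ) {i : N.I} {j : N.J} (hj : j ∈ N.Inc i) :
    N.interp f j (N.param i j) = f i := by
  have hl := (N.l_pos j).ne'
  unfold interp slope param
  split_ifs with h
  · simp [h]
  · rw [hj.resolve_left h, div_mul_cancel₀ _ hl, add_sub_cancel]

theorem isC2_interp (f : N.I → ℝ) : N.IsC2 (N.interp f) := by
  refine ⟨fun i j hj k hk => ?_, fun j => ?_⟩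
  · rw [N.interp_param f hj, N.interp_param f hk]
  · unfold interp
    fun_prop

theorem pd_interp (f : N.I → ℝ) (j : N.J) {x : ℝ} (hx : x ∈ N.edge j) :
    N.pd (N.interp f) j x = N.slope f j := by
  have h : HasDerivAt (N.interp f j) (N.slope f j) x := by
    have h := ((hasDerivAt_id x).const_mul (N.slope f j)).const_add (f (N.s j))
    rwa [mul_one] at h
  exact h.hasDerivWithinAt.derivWithin (uniqueDiffOn_Icc (N.l_pos j) x hx)

theorem param_mem_edge (i : N.I) (j : N.J) : N.param i j ∈ N.edge j := by
  have hl := (N.l_pos j).le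
  unfold param edge
  split_ifs
  · exact left_mem_Icc.2 hl
  · exact right_mem_Icc.2 hl

theorem sgn_mul_slope (f : N.I → ℝ) {i : N.I} {j : N.J} (hj : j ∈ N.Inc i) :
    N.sgn i j * N.slope f j = (f (N.opp i j) - f i) / N.l j := by
  unfold sgn slope opp
  split_ifs with h
  · rw [h, one_mul]
  · rw [hj.resolve_left h]
    ring

theorem kir_interp (β : N.I → N.J → ℝ) (f : N.I → ℝ) (i : N.I) :
    N.kir β (N.interp f) i =
      ∑ j, (if j ∈ N.Inc i then β i j / N.l j else 0) * (f (N.opp i j) - f i) := by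
  unfold kir incSum
  refine Finset.sum_congr rfl fun j _ => ?_
  split_ifs with hj
  · beta_reduce
    rw [N.pd_interp f j (N.param_mem_edge i j), mul_assoc, N.sgn_mul_slope f hj]
    ring
  · rw [zero_mul]

theorem exists_inc_opp_eq {i w : N.I} (h : N.graph.Adj i w) :
    ∃ j ∈ N.Inc i, N.opp i j = w := by
  obtain ⟨j, ⟨hs, ht⟩ | ⟨hs, ht⟩⟩ := h
  · exact ⟨j, Or.inl hs, by rw [opp, if_pos hs, ht]⟩
  · exact ⟨j, Or.inr ht, by rw [opp, if_neg fun h => N.st_ne j (h.trans ht.symm), hs]⟩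

end Network

open Network in
/-- **Lemma 4.2** (existence of a piecewise-affine function with positive Kirchhoff sums). -/
theorem exists_affine_positive_kirchhoff
    (N : Network) (β : N.I → N.J → ℝ)
    (hβ : ∀ i ∈ N.IT, ∀ j ∈ N.Inc i, 0 < β i j) :
    ∃ φ : N.J → ℝ → ℝ, ∃ α : N.J → ℝ, N.IsC2 φ ∧
      (∀ j, α j ≠ 0) ∧
      (∀ j, ∀ x ∈ N.edge j, N.pd φ j x = α j) ∧
      (∀ i ∈ N.IT, 0 < N.kir β φ i) := by
  classical
  obtain ⟨b, hb⟩ := N.IB_ne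
  obtain ⟨r, hr, hlow⟩ := N.graph_connected.exists_injective_rank b
  obtain ⟨ε, h0, h1, hε⟩ :=
    exists_mul_sum_lt_of_pos fun i j => if j ∈ N.Inc i then β i j / N.l j else 0
  refine ⟨N.interp fun i => ε ^ r i, N.slope fun i => ε ^ r i, N.isC2_interp _, fun j => ?_,
    fun j x hx => N.pd_interp _ j hx, fun i hi => ?_⟩
  · refine div_ne_zero (sub_ne_zero.2 fun h => N.st_ne j ?_) (N.l_pos j).ne'
    exact (hr (pow_right_injective₀ h0 h1.ne h)).symm
  · obtain ⟨w, hw, hlt⟩ := hlow i fun h => hi (h ▸ hb)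
    obtain ⟨j, hj, rfl⟩ := N.exists_inc_opp_eq hw
    have hpos (k : N.J) (hk : k ∈ N.Inc i) : 0 < β i k / N.l k :=
      div_pos (hβ i hi k hk) (N.l_pos k)
    rw [N.kir_interp]
    refine sum_mul_pow_sub_pow_pos (m := fun k => r (N.opp i k)) (j := j) (fun k => ?_) h0 h1
      (hε i j ?_) hlt
    · split_ifs with hk
      exacts [(hpos k hk).le, le_rfl]
    · rw [if_pos hj]
      exact hpos j hj
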